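/- arXiv:2507.00624 — 4 statements merged into one kernel-verified Lean document; each statement's English description precedes it below -/
import Mathlib

section
/- Norm minimization duality (complex version). Let M be a linear subspace of a complex normed space X and let x* ∈ X*. Then the distance from x* to the annihilator M^⊥ satisfies dist(x*, M^⊥) = sup{|x*(x)| : x ∈ M, ‖x‖ ≤ 1}, and the distance is attained: there exists m*_opt ∈ M^⊥ with ‖x* − m*_opt‖ = dist(x*, M^⊥). -/
open scoped ComplexConjugate


/-- **Norm minimization duality** (complex version): the distance from `x* ∈ X*` to the
annihilator `M^⊥` equals `sup{|x*(x)| : x ∈ M, ‖x‖ ≤ 1}`, and the distance is attained. -/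
theorem norm_min_duality {X : Type*} [NormedAddCommGroup X] [NormedSpace ℂ X]
    (M : Submodule ℂ X) (φ : X →L[ℂ] ℂ) :
    Metric.infDist φ {ψ : X →L[ℂ] ℂ | ∀ x ∈ M, ψ x = 0}
        = sSup {r : ℝ | ∃ x ∈ M, ‖x‖ ≤ 1 ∧ r = ‖φ x‖} ∧
      ∃ ψ : X →L[ℂ] ℂ, (∀ x ∈ M, ψ x = 0) ∧
        ‖φ - ψ‖ = Metric.infDist φ {ψ' : X →L[ℂ] ℂ | ∀ x ∈ M, ψ' x = 0} := by
  set φM : M →L[ℂ] ℂ := φ.comp M.subtypeL with hφM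
  obtain ⟨g, hg, hgnorm⟩ := exists_extension_norm_eq M φM
  have hmem : ∀ x ∈ M, (φ - g) x = 0 := fun x hx => by
    simpa [hφM, sub_eq_zero] using (hg ⟨x, hx⟩).symm
  have hdist : Metric.infDist φ {ψ : X →L[ℂ] ℂ | ∀ x ∈ M, ψ x = 0} = ‖φM‖ := by
    apply le_antisymm
    · refine (Metric.infDist_le_dist_of_mem (Set.mem_ofPred.2 hmem)).trans_eq ?_
      rw [dist_eq_norm, sub_sub_cancel, hgnorm]
    · refine (Metric.le_infDist ⟨φ - g, Set.mem_ofPred.2 hmem⟩).2 fun ψ hψ => ?_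
      rw [dist_eq_norm]
      refine φM.opNorm_le_bound (norm_nonneg _) fun x => ?_
      simpa [hφM, hψ x x.2] using (φ - ψ).le_opNorm x
  refine ⟨?_, φ - g, hmem, by rw [hdist, sub_sub_cancel, hgnorm]⟩
  rw [hdist, ← φM.sSup_unitClosedBall_eq_norm]
  congr 1
  ext r
  simp [hφM, eq_comm, and_left_comm]
end

section
/- Riesz factorization theorem (boundary-value form). A function f ∈ L¹(𝕋) belongs to H₁ if and only if there exist g, h ∈ H₂ such that f = g·h almost everywhere on 𝕋 and ‖f‖₁ = ‖g‖₂ · ‖h‖₂. -/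
open MeasureTheory Complex Real ComplexConjugate AddCircle
open scoped ENNReal NNReal

noncomputable section

instance fact_two_pi_pos : Fact (0 < 2 * π) := ⟨by positivity⟩

/-- The normalized Haar measure `dω/(2π)` on the circle `ℝ/2πℤ`. -/
abbrev μ𝕋 : Measure (AddCircle (2 * π)) := haarAddCircle

/-- The Hardy space `H_p`, as the subset of `L_p(𝕋)` of functions whose Fourier
coefficients `ĉ_n` vanish for all `n ≥ 1`. -/
def Hardy (p : ℝ≥0∞) : Set (Lp ℂ p μ𝕋) :=
  {f | ∀ n : ℤ, 1 ≤ n → fourierCoeff (f : AddCircle (2 * π) → ℂ) n = 0}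

/-- The subspace `H_∞^⊥` of `L_∞(𝕋)`: functions whose Fourier coefficients `ĉ_n`
vanish for all `n ≤ 0`. -/
def HinfPerp : Set (Lp ℂ ∞ μ𝕋) :=
  {f | ∀ n : ℤ, n ≤ 0 → fourierCoeff (f : AddCircle (2 * π) → ℂ) n = 0}


section FourierUniqueness

variable {T : ℝ} [hT : Fact (0 < T)]

lemma integral_mul_eq_zero_of_fourierCoeff_eq_zero {f : AddCircle T → ℂ}
    (hf : Integrable f haarAddCircle) (h : ∀ n, fourierCoeff f n = 0) (φ : C(AddCircle T, ℂ)) :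
    ∫ x, φ x * f x ∂haarAddCircle = 0 := by
  have hφ : ∀ φ : C(AddCircle T, ℂ), Integrable (fun x => φ x * f x) haarAddCircle := fun φ =>
    hf.bdd_mul φ.continuous.aestronglyMeasurable (.of_forall fun x => φ.norm_coe_le_norm x)
  let L : C(AddCircle T, ℂ) →ₗ[ℂ] ℂ :=
    { toFun := fun φ => ∫ x, φ x * f x ∂haarAddCircle
      map_add' := fun φ ψ => by
        rw [← integral_add (hφ φ) (hφ ψ)]
        simp [add_mul]
      map_smul' := fun c φ => by
        rw [RingHom.id_apply, smul_eq_mul, ← integral_const_mul]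
        simp [mul_assoc] }
  have hL : ∀ φ, ‖L φ‖ ≤ (∫ x, ‖f x‖ ∂haarAddCircle) * ‖φ‖ := fun φ => by
    rw [mul_comm, ← integral_const_mul]
    refine norm_integral_le_of_norm_le (hf.norm.const_mul _) (.of_forall fun x => ?_)
    rw [norm_mul]
    gcongr
    exact φ.norm_coe_le_norm x
  let L' : C(AddCircle T, ℂ) →L[ℂ] ℂ := L.mkContinuous _ hL
  have hker : (Submodule.span ℂ (Set.range (fourier (T := T)))).topologicalClosure ≤
      LinearMap.ker (L' : C(AddCircle T, ℂ) →ₗ[ℂ] ℂ) := by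
    refine Submodule.topologicalClosure_minimal _ (Submodule.span_le.2 ?_) L'.isClosed_ker
    rintro _ ⟨n, rfl⟩
    simpa [fourierCoeff] using! h (-n)
  rw [span_fourier_closure_eq_top] at hker
  exact hker (Submodule.mem_top (x := φ))

theorem ae_eq_zero_of_fourierCoeff_eq_zero {f : AddCircle T → ℂ}
    (hf : Integrable f haarAddCircle) (h : ∀ n, fourierCoeff f n = 0) :
    f =ᵐ[haarAddCircle] 0 := by
  refine ae_eq_zero_of_forall_setIntegral_isClosed_eq_zero hf fun s hs => ?_
  have hpos : ∀ n : ℕ, (0 : ℝ) < 1 / (n + 1) := fun n => by positivity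
  have hlim := tendsto_pi_nhds.1 (thickenedIndicator_tendsto_indicator_closure hpos
    tendsto_one_div_add_atTop_nhds_zero_nat s)
  rw [← integral_indicator hs.measurableSet]
  have hcont : ∀ n, Continuous fun x => ((thickenedIndicator (hpos n) s x : ℝ) : ℂ) := fun n =>
    continuous_ofReal.comp (NNReal.continuous_coe.comp (thickenedIndicator (hpos n) s).continuous)
  have key : Filter.Tendsto
      (fun n => ∫ x, ((thickenedIndicator (hpos n) s x : ℝ) : ℂ) * f x ∂haarAddCircle)
      Filter.atTop (nhds (∫ x, s.indicator f x ∂haarAddCircle)) := by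
    refine tendsto_integral_of_dominated_convergence (fun x => ‖f x‖)
      (fun n => (hcont n).aestronglyMeasurable.mul hf.aestronglyMeasurable) hf.norm
      (fun n => .of_forall fun x => ?_) (.of_forall fun x => ?_)
    · rw [norm_mul, norm_real, Real.norm_of_nonneg (NNReal.coe_nonneg _)]
      exact mul_le_of_le_one_left (norm_nonneg _)
        (NNReal.coe_le_one.2 (thickenedIndicator_le_one (hpos n) s x))
    · have hx := ((continuous_ofReal.comp NNReal.continuous_coe).tendsto _).comp (hlim x)
      rw [hs.closure_eq] at hx
      convert! hx.mul_const (f x) using 2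
      by_cases hxs : x ∈ s <;> simp [hxs]
  refine tendsto_nhds_unique key ?_
  exact tendsto_const_nhds.congr fun n =>
    (integral_mul_eq_zero_of_fourierCoeff_eq_zero hf h ⟨_, hcont n⟩).symm

end FourierUniqueness

section FourierHilbert

variable {T : ℝ} [hT : Fact (0 < T)] {a b : AddCircle T → ℂ}

lemma MeasureTheory.MemLp.fourier_mul {p : ℝ≥0∞} (ha : MemLp a p AddCircle.haarAddCircle) (n : ℤ) :
    MemLp (fun x => fourier n x * a x) p AddCircle.haarAddCircle := by
  refine ha.of_le ((fourier n).continuous.aestronglyMeasurable.mul ha.aestronglyMeasurable)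
    (.of_forall fun x => ?_)
  rw [norm_mul, fourier_apply, Circle.norm_coe, one_mul]

lemma MeasureTheory.MemLp.conj (ha : MemLp a 2 AddCircle.haarAddCircle) :
    MemLp (fun x => conj (a x)) 2 AddCircle.haarAddCircle :=
  ha.star

lemma inner_toLp_eq_integral (ha : MemLp a 2 haarAddCircle) (hb : MemLp b 2 haarAddCircle) :
    inner ℂ (ha.toLp a) (hb.toLp b) = ∫ x, conj (a x) * b x ∂haarAddCircle := by
  rw [L2.inner_def]
  refine integral_congr_ae ?_
  filter_upwards [ha.coeFn_toLp, hb.coeFn_toLp] with x h1 h2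
  rw [h1, h2, RCLike.inner_apply, mul_comm]

lemma inner_fourier_mul (ha : MemLp a 2 haarAddCircle) (hb : MemLp b 2 haarAddCircle)
    (m n : ℤ) :
    inner ℂ ((ha.fourier_mul m).toLp _) ((hb.fourier_mul n).toLp _) =
      fourierCoeff (fun x => conj (a x) * b x) (m - n) := by
  rw [inner_toLp_eq_integral, fourierCoeff]
  refine integral_congr_ae (.of_forall fun x => ?_)
  have : -(m - n) = -m + n := by ring
  simp only [map_mul, smul_eq_mul, this, fourier_add, fourier_neg]
  ring

lemma inner_fourier_mul_conj (ha : MemLp a 2 haarAddCircle) (hb : MemLp b 2 haarAddCircle)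
    (m n : ℤ) :
    inner ℂ ((ha.conj.fourier_mul m).toLp _) ((hb.fourier_mul n).toLp _) =
      fourierCoeff (fun x => a x * b x) (m - n) := by
  simpa using inner_fourier_mul ha.conj hb m n

lemma toLp_fourier_zero_mul (q : Lp ℂ 2 (haarAddCircle (T := T))) :
    ((Lp.memLp q).fourier_mul 0).toLp _ = q := by
  refine Lp.ext ?_
  filter_upwards [((Lp.memLp q).fourier_mul 0).coeFn_toLp] with x hx
  rw [hx, fourier_zero, one_mul]

theorem fourierCoeff_mul_eq_zero (ha : MemLp a 2 haarAddCircle) (hb : MemLp b 2 haarAddCircle)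
    (ha' : ∀ n : ℤ, 1 ≤ n → fourierCoeff a n = 0) (hb' : ∀ n : ℤ, 1 ≤ n → fourierCoeff b n = 0)
    (n : ℤ) (hn : 1 ≤ n) : fourierCoeff (fun x => a x * b x) n = 0 := by
  have h1 : MemLp (fun _ : AddCircle T => (1 : ℂ)) 2 haarAddCircle := memLp_const 1
  have hbasis : ∀ i : ℤ, fourierBasis (T := T) i = (h1.fourier_mul i).toLp _ := fun i => by
    rw [coe_fourierBasis]
    refine Lp.ext ((coeFn_fourierLp 2 i).trans ?_)
    filter_upwards [(h1.fourier_mul i).coeFn_toLp] with x hx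
    rw [hx, mul_one]
  have h := inner_fourier_mul_conj ha hb n 0
  rw [sub_zero] at h
  rw [← h, ← fourierBasis.tsum_inner_mul_inner]
  convert tsum_zero with i
  rcases le_or_gt 1 i with hi | hi
  · rw [← fourierBasis.repr_apply_apply, fourierBasis_repr,
      fourierCoeff_congr_ae (hb.fourier_mul 0).coeFn_toLp]
    simp [hb' i hi]
  · rw [hbasis, inner_fourier_mul_conj ha h1]
    simp [ha' (n - i) (by omega)]

end FourierHilbert

section InnerFactor

variable {T : ℝ} [hT : Fact (0 < T)]

/-- A function in `L²` orthogonal to its own products with all characters of positive index has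
constant modulus. -/
theorem norm_ae_eq_of_fourierCoeff_conj_mul_self (q : Lp ℂ 2 (haarAddCircle (T := T)))
    (h : ∀ n : ℤ, 1 ≤ n → fourierCoeff (fun x => conj (q x) * q x) n = 0) :
    ∀ᵐ x ∂haarAddCircle, ‖q x‖ = ‖q‖ := by
  have hq := Lp.memLp q
  have hint : Integrable (fun x => conj (q x) * q x) haarAddCircle := hq.conj.integrable_mul hq
  have hzero : fourierCoeff (fun x => conj (q x) * q x) 0 = (‖q‖ : ℂ) ^ 2 := by
    have := inner_fourier_mul hq hq 0 0
    rw [sub_zero, toLp_fourier_zero_mul, inner_self_eq_norm_sq_to_K] at this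
    exact this.symm
  have hall : ∀ n : ℤ, n ≠ 0 → fourierCoeff (fun x => conj (q x) * q x) n = 0 := by
    intro n hn
    rcases lt_or_gt_of_ne hn with hn | hn
    · have h1 := inner_fourier_mul hq hq (-n) 0
      have h2 := inner_fourier_mul hq hq 0 (-n)
      rw [sub_zero, h (-n) (by omega)] at h1
      rw [← inner_conj_symm, h1, zero_sub, neg_neg] at h2
      simpa using h2.symm
    · exact h n hn
  have hconst : ∀ n, fourierCoeff (T := T) (fun _ => (‖q‖ : ℂ) ^ 2) n =
      if n = 0 then (‖q‖ : ℂ) ^ 2 else 0 := by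
    intro n
    have := congrFun (fourierCoeff_fourier (T := T) 0) n
    have h2 := fourierCoeff.const_mul (T := T) (fourier 0) ((‖q‖ : ℂ) ^ 2) n
    rw [this] at h2
    simpa [Pi.single_apply] using h2
  have hae := ae_eq_zero_of_fourierCoeff_eq_zero (hint.sub (integrable_const ((‖q‖ : ℂ) ^ 2)))
    fun n => by
      rw [sub_eq_add_neg, fourierCoeff.add hint (integrable_const _).neg, ← neg_one_smul ℂ,
        Pi.add_apply, fourierCoeff.const_smul, hconst]
      by_cases hn : n = 0
      · simp [hn, hzero]
      · simp [hn, hall n hn]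
  filter_upwards [hae] with x hx
  simp only [Pi.sub_apply, Pi.zero_apply, conj_mul', sub_eq_zero] at hx
  exact (sq_eq_sq₀ (norm_nonneg _) (norm_nonneg _)).1 (by exact_mod_cast hx)

/-- Normalizing the component of `w` orthogonal to the closed span of its multiples by the characters
of negative index gives a unimodular `q` which moves `w` and `u` into the Hardy space whenever `u * w`
is nonzero and belongs to it. -/
theorem exists_unimodular_factor {u w : AddCircle T → ℂ} (hu : MemLp u 2 haarAddCircle)
    (hw : MemLp w 2 haarAddCircle)
    (h : ∀ n : ℤ, 1 ≤ n → fourierCoeff (fun x => u x * w x) n = 0)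
    (hne : ¬ (fun x => u x * w x) =ᵐ[haarAddCircle] 0) :
    ∃ q : AddCircle T → ℂ, AEStronglyMeasurable q haarAddCircle ∧
      (∀ᵐ x ∂haarAddCircle, ‖q x‖ = 1) ∧
      (∀ n : ℤ, 1 ≤ n → fourierCoeff (fun x => conj (q x) * w x) n = 0) ∧
      ∀ n : ℤ, 1 ≤ n → fourierCoeff (fun x => u x * q x) n = 0 := by
  obtain ⟨m, hm, hmax⟩ : ∃ m : ℤ, fourierCoeff (fun x => u x * w x) m ≠ 0 ∧
      ∀ n, m < n → fourierCoeff (fun x => u x * w x) n = 0 := by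
    have hex : ∃ m, fourierCoeff (fun x => u x * w x) m ≠ 0 := by
      by_contra! hall
      exact hne (ae_eq_zero_of_fourierCoeff_eq_zero (hu.integrable_mul hw) hall)
    obtain ⟨m, hm, hmax⟩ := Int.exists_greatest_of_bdd
      ⟨0, fun z hz => by_contra fun hz' => hz (h z (by omega))⟩ hex
    exact ⟨m, hm, fun n hn => by_contra fun hn' => absurd (hmax n hn') (by omega)⟩
  let W : ℤ → Lp ℂ 2 (haarAddCircle (T := T)) := fun n => (hw.fourier_mul (-n)).toLp _
  let N : Submodule ℂ (Lp ℂ 2 (haarAddCircle (T := T))) :=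
    (Submodule.span ℂ (Set.image W (Set.Ici 1))).topologicalClosure
  have : CompleteSpace N := (Submodule.isClosed_topologicalClosure _).completeSpace_coe
  have hN : ∀ a, (∀ n, 1 ≤ n → inner ℂ a (W n) = 0) → ∀ y ∈ N, inner ℂ a y = 0 := by
    intro a ha y hy
    have hle : N ≤ LinearMap.ker (innerSL ℂ a : _ →ₗ[ℂ] ℂ) := by
      refine Submodule.topologicalClosure_minimal _ (Submodule.span_le.2 ?_)
        (innerSL ℂ a).isClosed_ker
      rintro _ ⟨n, hn, rfl⟩
      simpa using! ha n hn
    simpa using! hle hy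
  have hWN : ∀ n, 1 ≤ n → W n ∈ N := fun n hn =>
    Submodule.le_topologicalClosure _ (Submodule.subset_span ⟨n, hn, rfl⟩)
  set q := W 0 - N.starProjection (W 0) with hq_def
  have hq := Lp.memLp q
  have hqN : ∀ y ∈ N, inner ℂ q y = 0 :=
    (N.mem_orthogonal' _).1 (N.sub_starProjection_mem_orthogonal (W 0))
  have hqperp : ∀ a, (∀ n, 0 ≤ n → inner ℂ a (W n) = 0) → inner ℂ a q = 0 := fun a ha => by
    rw [hq_def, inner_sub_right, ha 0 le_rfl,
      hN a (fun n hn => ha n (by omega)) _ (N.starProjection_apply_mem _), sub_zero]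
  have hA : ∀ k n : ℤ, inner ℂ ((hu.conj.fourier_mul k).toLp _) (W n) =
      fourierCoeff (fun x => u x * w x) (k + n) := fun k n => by
    rw [inner_fourier_mul_conj hu hw, sub_neg_eq_add]
  have hQ : ∀ k n : ℤ, inner ℂ ((hq.fourier_mul k).toLp _) (W n) =
      fourierCoeff (fun x => conj (q x) * w x) (k + n) := fun k n => by
    rw [inner_fourier_mul hq hw, sub_neg_eq_add]
  have hq0 : q ≠ 0 := by
    intro h0
    have hmem : W 0 ∈ N := by
      rw [sub_eq_zero.1 (hq_def.symm.trans h0)]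
      exact N.starProjection_apply_mem _
    refine hm ?_
    rw [← add_zero m, ← hA]
    exact hN _ (fun n hn => by rw [hA, hmax _ (by omega)]) _ hmem
  have hqw : ∀ n : ℤ, 1 ≤ n → fourierCoeff (fun x => conj (q x) * w x) n = 0 := fun n hn => by
    rw [← zero_add n, ← hQ, toLp_fourier_zero_mul]
    exact hqN _ (hWN n hn)
  have huq : ∀ n : ℤ, 1 ≤ n → fourierCoeff (fun x => u x * q x) n = 0 := fun n hn => by
    rw [← sub_zero n, ← inner_fourier_mul_conj hu hq, toLp_fourier_zero_mul]
    exact hqperp _ fun k hk => by rw [hA, h _ (by omega)]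
  have hnorm := norm_ae_eq_of_fourierCoeff_conj_mul_self q fun n hn => by
    rw [← sub_zero n, ← inner_fourier_mul hq hq, toLp_fourier_zero_mul]
    exact hqperp _ fun k hk => by rw [hQ, hqw _ (by omega)]
  refine ⟨fun x => (‖q‖ : ℂ)⁻¹ * q x, hq.aestronglyMeasurable.const_mul _, ?_,
    fun n hn => ?_, fun n hn => ?_⟩
  · filter_upwards [hnorm] with x hx
    simp [hx, hq0]
  · simp only [map_mul, mul_assoc, fourierCoeff.const_mul, hqw n hn, mul_zero]
  · simp only [fun x => mul_left_comm (u x) (‖q‖ : ℂ)⁻¹ (q x), fourierCoeff.const_mul, huq n hn,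
      mul_zero]

end InnerFactor

lemma Lp.norm_two_sq_eq_norm_one {α : Type*} [MeasurableSpace α] {μ : Measure α}
    (g : Lp ℂ 2 μ) (f : Lp ℂ 1 μ) (h : ∀ᵐ x ∂μ, ‖g x‖ ^ 2 = ‖f x‖) : ‖g‖ ^ 2 = ‖f‖ := by
  have h1 : inner ℂ g g = ((∫ x, ‖f x‖ ∂μ : ℝ) : ℂ) := by
    rw [L2.inner_def, ← integral_complex_ofReal]
    refine integral_congr_ae ?_
    filter_upwards [h] with x hx
    rw [inner_self_eq_norm_sq_to_K, ← hx]
    simp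
  rw [inner_self_eq_norm_sq_to_K, ← L1.norm_eq_integral_norm] at h1
  exact ofReal_injective (by simpa using h1)

/-- **Riesz factorization theorem** (boundary-value form): `f ∈ L¹(𝕋)` belongs to `H₁` iff
`f = g·h` a.e. with `g, h ∈ H₂` and `‖f‖₁ = ‖g‖₂·‖h‖₂`. -/
theorem riesz_factorization (f : Lp ℂ 1 μ𝕋) :
    f ∈ Hardy 1 ↔ ∃ g h : Lp ℂ 2 μ𝕋, g ∈ Hardy 2 ∧ h ∈ Hardy 2 ∧
      (f : AddCircle (2 * π) → ℂ) =ᵐ[μ𝕋]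
        (g : AddCircle (2 * π) → ℂ) * (h : AddCircle (2 * π) → ℂ) ∧
      ‖f‖ = ‖g‖ * ‖h‖ := by
  constructor
  · intro hf
    by_cases hf0 : f = 0
    · refine ⟨0, 0, ?_, ?_, ?_, by simp [hf0]⟩
      · exact fun n _ => by rw [fourierCoeff_congr_ae (Lp.coeFn_zero ℂ 2 μ𝕋)]; simp [fourierCoeff]
      · exact fun n _ => by rw [fourierCoeff_congr_ae (Lp.coeFn_zero ℂ 2 μ𝕋)]; simp [fourierCoeff]
      · subst hf0
        filter_upwards [Lp.coeFn_zero ℂ 1 μ𝕋, Lp.coeFn_zero ℂ 2 μ𝕋] with x h1 h2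
        rw [Pi.mul_apply, h1, h2]
        simp
    have hfi : Integrable f μ𝕋 := L1.integrable_coeFn f
    let w : AddCircle (2 * π) → ℂ := fun x => (√‖f x‖ : ℝ)
    let u : AddCircle (2 * π) → ℂ := fun x => f x / w x
    have hwn : ∀ x, ‖w x‖ ^ 2 = ‖f x‖ := fun x => by simp [w, Real.sq_sqrt]
    have huw : ∀ x, u x * w x = f x := fun x => by
      by_cases hx : f x = 0
      · simp [u, hx]
      · exact div_mul_cancel₀ _ (by simpa [w, Real.sqrt_eq_zero'] using hx)
    have hun : ∀ x, ‖u x‖ ^ 2 = ‖f x‖ := fun x => by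
      rw [norm_div, div_pow, hwn, sq, mul_self_div_self]
    have hwm : AEStronglyMeasurable w μ𝕋 :=
      (continuous_ofReal.comp Real.continuous_sqrt).comp_aestronglyMeasurable
        hfi.aestronglyMeasurable.norm
    have hum : AEStronglyMeasurable u μ𝕋 :=
      (hfi.aestronglyMeasurable.aemeasurable.div hwm.aemeasurable).aestronglyMeasurable
    have hmem : ∀ v : AddCircle (2 * π) → ℂ, AEStronglyMeasurable v μ𝕋 →
        (∀ᵐ x ∂μ𝕋, ‖v x‖ ^ 2 = ‖f x‖) → MemLp v 2 μ𝕋 := fun v hv hvn =>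
      (memLp_two_iff_integrable_sq_norm hv).2 (hfi.norm.congr (hvn.mono fun x hx => hx.symm))
    have hw := hmem w hwm (.of_forall hwn)
    have hu := hmem u hum (.of_forall hun)
    obtain ⟨q, hqm, hq1, hqw, huq⟩ := exists_unimodular_factor hu hw
      (by simp only [huw]; exact hf)
      (fun h0 => hf0 (Lp.eq_zero_iff_ae_eq_zero.2 (by simpa only [huw] using h0)))
    have hgn : ∀ᵐ x ∂μ𝕋, ‖conj (q x) * w x‖ ^ 2 = ‖f x‖ := by
      filter_upwards [hq1] with x hx
      rw [norm_mul, RCLike.norm_conj, hx, one_mul, hwn]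
    have hhn : ∀ᵐ x ∂μ𝕋, ‖u x * q x‖ ^ 2 = ‖f x‖ := by
      filter_upwards [hq1] with x hx
      rw [norm_mul, hx, mul_one, hun]
    have hg := hmem _ (hqm.star.mul hwm) hgn
    have hh := hmem _ (hum.mul hqm) hhn
    refine ⟨hg.toLp _, hh.toLp _, fun n hn => ?_, fun n hn => ?_, ?_, ?_⟩
    · rw [fourierCoeff_congr_ae hg.coeFn_toLp]
      exact hqw n hn
    · rw [fourierCoeff_congr_ae hh.coeFn_toLp]
      exact huq n hn
    · filter_upwards [hg.coeFn_toLp, hh.coeFn_toLp, hq1] with x h1 h2 h3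
      have hqq : conj (q x) * q x = 1 := by rw [conj_mul', h3]; simp
      rw [Pi.mul_apply, h1, h2]
      change f x = conj (q x) * w x * (u x * q x)
      linear_combination -(huw x) - u x * w x * hqq
    · have h1 := Lp.norm_two_sq_eq_norm_one (hg.toLp _) f <| by
        filter_upwards [hg.coeFn_toLp, hgn] with x h1 h2
        rw [h1]
        exact h2
      have h2 := Lp.norm_two_sq_eq_norm_one (hh.toLp _) f <| by
        filter_upwards [hh.coeFn_toLp, hhn] with x h1 h2
        rw [h1]
        exact h2
      rw [← (sq_eq_sq₀ (norm_nonneg _) (norm_nonneg _)).1 (h1.trans h2.symm), ← sq, h1]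
  · rintro ⟨g, h, hg, hh, hfgh, -⟩ n hn
    rw [fourierCoeff_congr_ae hfgh]
    exact fourierCoeff_mul_eq_zero (Lp.memLp g) (Lp.memLp h) hg hh n hn

end
end

section
/- Distance from L_∞(𝕋) to H_∞ via the predual. For every h ∈ L_∞(𝕋), the distance inf{‖h − f‖_∞ : f ∈ H_∞} is attained by some f_opt ∈ H_∞, and equals sup{ |(1/2π)∫_{-π}^{π} h(e^{iω}) x(e^{iω}) dω| : x ∈ L¹(𝕋), ĉ_n(x) = 0 for all n ≥ 0, ‖x‖₁ ≤ 1 }. -/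
open MeasureTheory Complex Real ComplexConjugate AddCircle
open scoped ENNReal NNReal

noncomputable section

theorem norm_le_ae_of_integral_sq_le {α : Type*} {m : MeasurableSpace α} {μ : Measure α}
    [IsFiniteMeasure μ] {g : α → ℂ} (hgm : StronglyMeasurable g) (hg : MemLp g 2 μ) {C : ℝ}
    (hC : 0 ≤ C)
    (hle : ∀ s, MeasurableSet s → ∫ t in s, ‖g t‖ ^ 2 ∂μ ≤ C * ∫ t in s, ‖g t‖ ∂μ) :
    ∀ᵐ t ∂μ, ‖g t‖ ≤ C := by
  set s : Set α := {t | C < ‖g t‖}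
  have hs : MeasurableSet s := measurableSet_lt measurable_const hgm.norm.measurable
  have h1 : Integrable (fun t ↦ ‖g t‖) μ := (hg.integrable one_le_two).norm
  have h2 : Integrable (fun t ↦ ‖g t‖ ^ 2) μ := hg.norm.integrable_sq
  have hint : Integrable (fun t ↦ ‖g t‖ ^ 2 - C * ‖g t‖) (μ.restrict s) :=
    (h2.sub (h1.const_mul C)).integrableOn
  have hnonneg : 0 ≤ᵐ[μ.restrict s] fun t ↦ ‖g t‖ ^ 2 - C * ‖g t‖ := by
    filter_upwards [ae_restrict_mem hs] with t ht
    have ht' : C < ‖g t‖ := ht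
    simp only [Pi.zero_apply]
    nlinarith [norm_nonneg (g t)]
  have hzero : ∫ t in s, (‖g t‖ ^ 2 - C * ‖g t‖) ∂μ = 0 := by
    refine le_antisymm ?_ (integral_nonneg_of_ae hnonneg)
    rw [integral_sub h2.integrableOn (h1.const_mul C).integrableOn, integral_const_mul]
    linarith [hle s hs]
  have hae := (ae_restrict_iff' hs).1 ((integral_eq_zero_iff_of_nonneg_ae hnonneg hint).1 hzero)
  filter_upwards [hae] with t ht
  by_contra! hlt
  have := ht hlt
  simp only [Pi.zero_apply] at this
  nlinarith

theorem exists_Linfty_representing {α : Type*} {m : MeasurableSpace α} {μ : Measure α}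
    [IsProbabilityMeasure μ] (Φ : StrongDual ℂ (Lp ℂ 1 μ)) :
    ∃ g : Lp ℂ ∞ μ, ‖g‖ ≤ ‖Φ‖ ∧
      ∀ (f : α → ℂ) (_ : MemLp f 2 μ) (hf : MemLp f 1 μ), Φ hf.toLp = ∫ t, g t * f t ∂μ := by
  let J : Lp ℂ 2 μ →L[ℂ] Lp ℂ 1 μ :=
    (ContinuousLinearMap.mul ℂ ℂ).holderL μ 2 2 1 ((memLp_const (1 : ℂ)).toLp)
  have hJ : ∀ f : Lp ℂ 2 μ, J f =ᵐ[μ] f := fun f ↦ by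
    filter_upwards [(ContinuousLinearMap.mul ℂ ℂ).coeFn_holder (r := 1)
      ((memLp_const (1 : ℂ)).toLp : Lp ℂ 2 μ) f,
      (memLp_const (p := 2) (μ := μ) (1 : ℂ)).coeFn_toLp] with t h1 h2
    simp only [J, ContinuousLinearMap.holderL_apply_apply]
    rw [h1, h2]
    simp
  set g₀ : Lp ℂ 2 μ := (InnerProductSpace.toDual ℂ (Lp ℂ 2 μ)).symm (Φ ∘L J) with hg₀
  have hrep : ∀ (f : α → ℂ) (_ : MemLp f 2 μ) (hf : MemLp f 1 μ),
      Φ hf.toLp = ∫ t, conj (g₀ t) * f t ∂μ := fun f hf2 hf1 ↦ by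
    have h1 : J hf2.toLp = hf1.toLp :=
      Lp.ext (((hJ _).trans hf2.coeFn_toLp).trans hf1.coeFn_toLp.symm)
    have h2 : inner ℂ g₀ hf2.toLp = Φ (J hf2.toLp) := by
      rw [hg₀, InnerProductSpace.toDual_symm_apply, ContinuousLinearMap.comp_apply]
    rw [← h1, ← h2, L2.inner_def]
    refine integral_congr_ae ?_
    filter_upwards [hf2.coeFn_toLp] with t ht
    rw [ht, RCLike.inner_apply, mul_comm]
  have hbound : ∀ᵐ t ∂μ, ‖g₀ t‖ ≤ ‖Φ‖ := by
    refine norm_le_ae_of_integral_sq_le (Lp.stronglyMeasurable g₀) (Lp.memLp g₀)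
      (norm_nonneg _) fun s hs ↦ ?_
    have hf2 : MemLp (s.indicator g₀) 2 μ := (Lp.memLp g₀).indicator hs
    have hf1 : MemLp (s.indicator g₀) 1 μ := hf2.mono_exponent one_le_two
    have h := Φ.le_opNorm hf1.toLp
    have h3 : ∫ t, conj (g₀ t) * s.indicator g₀ t ∂μ = ((∫ t in s, ‖g₀ t‖ ^ 2 ∂μ : ℝ) : ℂ) := by
      rw [← integral_complex_ofReal, ← integral_indicator hs]
      refine integral_congr_ae (.of_forall fun t ↦ ?_)
      by_cases ht : t ∈ s
      · simp [ht, Complex.conj_mul']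
      · simp [ht]
    have h4 : ‖hf1.toLp‖ = ∫ t in s, ‖g₀ t‖ ∂μ := by
      rw [L1.norm_eq_integral_norm, ← integral_indicator hs]
      refine integral_congr_ae ?_
      filter_upwards [hf1.coeFn_toLp] with t ht
      rw [ht, norm_indicator_eq_indicator_norm]
    rw [hrep _ hf2 hf1, h3, h4, Complex.norm_real] at h
    exact (le_abs_self _).trans h
  have hgm : MemLp (fun t ↦ conj (g₀ t)) ∞ μ :=
    memLp_top_of_bound (Complex.continuous_conj.comp_aestronglyMeasurable
      (Lp.aestronglyMeasurable g₀)) ‖Φ‖ (by simpa using hbound)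
  refine ⟨hgm.toLp, ?_, fun f hf2 hf1 ↦ ?_⟩
  · have : ∀ᵐ t ∂μ, ‖(hgm.toLp : Lp ℂ ∞ μ) t‖ ≤ ‖Φ‖ := by
      filter_upwards [hgm.coeFn_toLp, hbound] with t h1 h2
      rw [h1, RCLike.norm_conj]
      exact h2
    simpa using Lp.norm_le_of_ae_bound (norm_nonneg _) this
  · rw [hrep f hf2 hf1]
    refine integral_congr_ae ?_
    filter_upwards [hgm.coeFn_toLp] with t ht
    rw [ht]

theorem eq_zero_of_fourierCoeff_eq_zero {T : ℝ} [Fact (0 < T)] {F : AddCircle T → ℂ}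
    (hF : Continuous F) (h : ∀ n, fourierCoeff F n = 0) : F = 0 := by
  have hm : MemLp F 2 (haarAddCircle (T := T)) :=
    MemLp.of_bound hF.aestronglyMeasurable ‖(⟨F, hF⟩ : C(AddCircle T, ℂ))‖
      (.of_forall fun t ↦ ContinuousMap.norm_coe_le_norm ⟨F, hF⟩ t)
  have h0 : hm.toLp = 0 := by
    refine (fourierBasis (T := T)).repr.injective (lp.ext (funext fun n ↦ ?_))
    rw [fourierBasis_repr, fourierCoeff_congr_ae hm.coeFn_toLp, h, map_zero]
    rfl
  have hae : F =ᵐ[haarAddCircle (T := T)] 0 := by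
    filter_upwards [hm.coeFn_toLp, Lp.coeFn_zero ℂ 2 (haarAddCircle (T := T))] with t h1 h2
    rw [← h1, h0, h2]
  exact (hF.ae_eq_iff_eq _ continuous_const).1 hae

theorem integrable_mul_comp_add {G : Type*} [AddCommGroup G] [MeasurableSpace G] [MeasurableAdd₂ G]
    {μ : Measure G} [SFinite μ] [μ.IsAddLeftInvariant]
    {f x : G → ℂ} (hf : Integrable f μ) (hx : Integrable x μ) :
    Integrable (fun q : G × G ↦ f q.1 * x (q.1 + q.2)) (μ.prod μ) :=
  (measurePreserving_prod_add μ μ).integrable_comp_of_integrable (hf.mul_prod hx)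

theorem fourierCoeff_correlation {T : ℝ} [Fact (0 < T)] {f x : AddCircle T → ℂ}
    (hf : Integrable f haarAddCircle) (hx : Integrable x haarAddCircle) (n : ℤ) :
    fourierCoeff (fun t ↦ ∫ s, f s * x (s + t) ∂haarAddCircle) n
      = fourierCoeff f (-n) * fourierCoeff x n := by
  have hint : Integrable (fun q : AddCircle T × AddCircle T ↦
      fourier (-n) q.1 * (f q.2 * x (q.2 + q.1))) (haarAddCircle.prod haarAddCircle) := by
    refine (integrable_mul_comp_add hf hx).swap.bdd_mul (c := 1)
      ((map_continuous (fourier (-n))).comp continuous_fst).aestronglyMeasurable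
      (.of_forall fun q ↦ (Circle.norm_coe _).le)
  have hinner : ∀ s, ∫ t, fourier (-n) t * (f s * x (s + t)) ∂haarAddCircle
      = fourier (- -n) s * f s * fourierCoeff x n := fun s ↦ by
    have h1 : ∀ t, fourier (-n) t * (f s * x (s + t))
        = fourier (- -n) s * f s * (fourier (-n) (s + t) * x (s + t)) := fun t ↦ by
      have h2 : fourier (-n) (s + t) = fourier (-n) s * fourier (-n) t := by
        simp only [fourier_apply, smul_add, toCircle_add, Circle.coe_mul]
      have h3 : fourier (- -n) s * fourier (-n) s = 1 := by
        rw [← fourier_add, neg_add_cancel, fourier_zero]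
      rw [h2]
      linear_combination -(fourier (-n) t * f s * x (s + t)) * h3
    simp_rw [h1]
    rw [integral_const_mul, integral_add_left_eq_self (fun t ↦ fourier (-n) t * x t)]
    rfl
  rw [fourierCoeff]
  simp_rw [smul_eq_mul, ← integral_const_mul]
  rw [integral_integral_swap hint]
  simp_rw [hinner]
  rw [integral_mul_const]
  rfl

theorem continuous_correlation {T : ℝ} [Fact (0 < T)]
    (f : Lp ℂ ∞ (haarAddCircle (T := T))) (x : Lp ℂ 1 (haarAddCircle (T := T))) :
    Continuous fun t ↦ ∫ s, f s * x (s + t) ∂haarAddCircle := by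
  have : Fact ((1 : ℝ≥0∞) ≠ ∞) := ⟨ENNReal.one_ne_top⟩
  have hc : Continuous fun t : AddCircle T ↦
    (ContinuousLinearMap.mul ℂ ℂ).lpPairing haarAddCircle ∞ 1 f (DomAddAct.mk t +ᵥ x) :=
    ((ContinuousLinearMap.mul ℂ ℂ).lpPairing haarAddCircle ∞ 1 f).continuous.comp
      ((DomAddAct.continuous_mk (M := AddCircle T)).vadd continuous_const)
  convert hc using 2 with t
  rw [ContinuousLinearMap.lpPairing_eq_integral]
  refine integral_congr_ae ?_
  filter_upwards [DomAddAct.vadd_Lp_ae_eq (DomAddAct.mk t) x] with s hs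
  rw [hs]
  simp [add_comm]

theorem integral_mul_eq_zero_of_fourierCoeff {T : ℝ} [Fact (0 < T)]
    (f : Lp ℂ ∞ (haarAddCircle (T := T))) (x : Lp ℂ 1 (haarAddCircle (T := T)))
    (h : ∀ n, fourierCoeff f (-n) * fourierCoeff x n = 0) :
    ∫ s, f s * x s ∂haarAddCircle = 0 := by
  have h0 := eq_zero_of_fourierCoeff_eq_zero (continuous_correlation f x) fun n ↦ by
    rw [fourierCoeff_correlation ((Lp.memLp f).integrable le_top) (L1.integrable_coeFn x), h]
  simpa using congrFun h0 0

/-- The pre-annihilator of `H_∞`: functions in `L¹(𝕋)` whose Fourier coefficients `ĉ_n` vanish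
for all `n ≥ 0`. -/
def hardyPreannihilator : Subspace ℂ (Lp ℂ 1 μ𝕋) where
  carrier := {x | ∀ n : ℤ, 0 ≤ n → fourierCoeff (x : AddCircle (2 * π) → ℂ) n = 0}
  zero_mem' n _ := by
    rw [fourierCoeff_congr_ae (Lp.coeFn_zero ℂ 1 μ𝕋)]
    simp [fourierCoeff]
  add_mem' {x y} hx hy n hn := by
    rw [fourierCoeff_congr_ae (Lp.coeFn_add x y),
      fourierCoeff.add (L1.integrable_coeFn x) (L1.integrable_coeFn y), Pi.add_apply, hx n hn,
      hy n hn, add_zero]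
  smul_mem' c x hx n hn := by
    rw [fourierCoeff_congr_ae (Lp.coeFn_smul c x), fourierCoeff.const_smul, hx n hn, smul_zero]

/-- The functional `x ↦ ∫ h x` on `L¹(𝕋)` induced by `h ∈ L_∞(𝕋)`. -/
def pairing (h : Lp ℂ ∞ μ𝕋) : StrongDual ℂ (Lp ℂ 1 μ𝕋) :=
  (ContinuousLinearMap.mul ℂ ℂ).lpPairing μ𝕋 ∞ 1 h

theorem pairing_apply (h : Lp ℂ ∞ μ𝕋) (x : Lp ℂ 1 μ𝕋) : pairing h x = ∫ t, h t * x t ∂μ𝕋 :=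
  ContinuousLinearMap.lpPairing_eq_integral _ h x

theorem norm_pairing_apply_le (h : Lp ℂ ∞ μ𝕋) (x : Lp ℂ 1 μ𝕋) : ‖pairing h x‖ ≤ ‖h‖ * ‖x‖ := by
  have h1 : pairing h x = ∫ t, (ContinuousLinearMap.mul ℂ ℂ).holder 1 h x t ∂μ𝕋 := by
    rw [pairing_apply]
    exact integral_congr_ae ((ContinuousLinearMap.mul ℂ ℂ).coeFn_holder (r := 1) h x).symm
  rw [h1]
  refine (norm_integral_le_integral_norm _).trans ?_
  rw [← L1.norm_eq_integral_norm]
  simpa using (ContinuousLinearMap.mul ℂ ℂ).norm_holder_apply_apply_le (r := 1) h x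

theorem pairing_eq_zero {f : Lp ℂ ∞ μ𝕋} (hf : f ∈ Hardy ∞) {x : Lp ℂ 1 μ𝕋}
    (hx : x ∈ hardyPreannihilator) : pairing f x = 0 := by
  rw [pairing_apply]
  refine integral_mul_eq_zero_of_fourierCoeff f x fun n ↦ ?_
  rcases le_or_gt 0 n with hn | hn
  · rw [hx n hn, mul_zero]
  · rw [hf (-n) (by omega), zero_mul]

theorem norm_pairing_le_norm_sub {h f : Lp ℂ ∞ μ𝕋} (hf : f ∈ Hardy ∞) {x : Lp ℂ 1 μ𝕋}
    (hx : x ∈ hardyPreannihilator) (hx1 : ‖x‖ ≤ 1) : ‖pairing h x‖ ≤ ‖h - f‖ := by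
  have h1 : pairing h x = pairing (h - f) x := by
    rw [← sub_zero (pairing h x), ← pairing_eq_zero hf hx]
    simp only [pairing, map_sub, sub_apply]
  rw [h1]
  exact (norm_pairing_apply_le _ x).trans (mul_le_of_le_one_right (norm_nonneg _) hx1)

theorem exists_hardy_norm_sub_le (h : Lp ℂ ∞ μ𝕋) {C : ℝ} (hC : 0 ≤ C)
    (hle : ∀ x ∈ hardyPreannihilator, ‖x‖ ≤ 1 → ‖pairing h x‖ ≤ C) :
    ∃ f ∈ Hardy ∞, ‖h - f‖ ≤ C := by
  obtain ⟨Φ, hΦ, hΦn⟩ := exists_extension_norm_eq hardyPreannihilator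
    ((pairing h).comp hardyPreannihilator.subtypeL)
  obtain ⟨g, hg, hgrep⟩ := exists_Linfty_representing Φ
  have hnorm : ‖Φ‖ ≤ C := by
    rw [hΦn]
    exact ContinuousLinearMap.opNorm_le_of_unit_norm hC fun x hx ↦ hle x x.2 hx.le
  refine ⟨h - g, fun n hn ↦ ?_, by simpa using hg.trans hnorm⟩
  have he : ∀ p : ℝ≥0∞, MemLp (fourier (-n) : AddCircle (2 * π) → ℂ) p μ𝕋 := fun p ↦
    MemLp.of_bound (map_continuous _).aestronglyMeasurable 1
      (.of_forall fun t ↦ (Circle.norm_coe _).le)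
  have hmem : (he 1).toLp ∈ hardyPreannihilator := fun m hm ↦ by
    rw [fourierCoeff_congr_ae (he 1).coeFn_toLp, fourierCoeff_fourier, Pi.single_eq_of_ne (by omega)]
  have h1 : ∫ t, g t * fourier (-n) t ∂μ𝕋 = ∫ t, h t * fourier (-n) t ∂μ𝕋 := by
    rw [← hgrep _ (he 2) (he 1), hΦ ⟨_, hmem⟩]
    refine (pairing_apply _ _).trans (integral_congr_ae ?_)
    filter_upwards [(he 1).coeFn_toLp] with t ht
    rw [← ht]
    rfl
  have hint : ∀ f : Lp ℂ ∞ μ𝕋, Integrable (fun t ↦ f t * fourier (-n) t) μ𝕋 := fun f ↦ by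
    simpa only [smul_eq_mul, mul_comm] using ((Lp.memLp f).integrable le_top).fourier_smul (-n)
  rw [fourierCoeff_congr_ae (Lp.coeFn_sub h g)]
  simp only [fourierCoeff, smul_eq_mul, Pi.sub_apply, mul_comm (fourier (-n) _), sub_mul]
  rw [integral_sub (hint h) (hint g), h1, sub_self]

/-- **Distance from `L_∞(𝕋)` to `H_∞` via the predual**: the distance
`inf{‖h − f‖_∞ : f ∈ H_∞}` is attained, and equals
`sup{|(1/2π)∫ h x dω| : x ∈ L¹(𝕋), ĉ_n(x) = 0 ∀ n ≥ 0, ‖x‖₁ ≤ 1}`. -/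
theorem dist_to_Hinf_predual (h : Lp ℂ ∞ μ𝕋) :
    (∃ fopt ∈ Hardy ∞, ‖h - fopt‖ = ⨅ f : Hardy ∞, ‖h - (f : Lp ℂ ∞ μ𝕋)‖) ∧
    (⨅ f : Hardy ∞, ‖h - (f : Lp ℂ ∞ μ𝕋)‖)
      = sSup {r : ℝ | ∃ x : Lp ℂ 1 μ𝕋,
          (∀ n : ℤ, 0 ≤ n → fourierCoeff (x : AddCircle (2 * π) → ℂ) n = 0) ∧ ‖x‖ ≤ 1 ∧
          r = ‖∫ t, (h : AddCircle (2 * π) → ℂ) t * (x : AddCircle (2 * π) → ℂ) t ∂μ𝕋‖} := by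
  set S : Set ℝ := {r : ℝ | ∃ x : Lp ℂ 1 μ𝕋,
    (∀ n : ℤ, 0 ≤ n → fourierCoeff (x : AddCircle (2 * π) → ℂ) n = 0) ∧ ‖x‖ ≤ 1 ∧
    r = ‖∫ t, (h : AddCircle (2 * π) → ℂ) t * (x : AddCircle (2 * π) → ℂ) t ∂μ𝕋‖}
  have hS : ∀ f ∈ Hardy ∞, ∀ r ∈ S, r ≤ ‖h - f‖ := by
    rintro f hf r ⟨x, hx, hx1, rfl⟩
    rw [← pairing_apply]
    exact norm_pairing_le_norm_sub hf hx hx1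
  have hzero : (0 : Lp ℂ ∞ μ𝕋) ∈ Hardy ∞ := fun n _ ↦ by
    rw [fourierCoeff_congr_ae (Lp.coeFn_zero ℂ ∞ μ𝕋)]
    simp [fourierCoeff]
  have : Nonempty (Hardy ∞) := ⟨⟨0, hzero⟩⟩
  have hbdd : BddAbove S := ⟨_, hS 0 hzero⟩
  have hnonneg : 0 ≤ sSup S := Real.sSup_nonneg (by rintro r ⟨x, -, -, rfl⟩; positivity)
  obtain ⟨fopt, hfopt, hle⟩ := exists_hardy_norm_sub_le h hnonneg fun x hx hx1 ↦
    le_csSup hbdd ⟨x, hx, hx1, by rw [pairing_apply]⟩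
  have hge : sSup S ≤ ⨅ f : Hardy ∞, ‖h - (f : Lp ℂ ∞ μ𝕋)‖ :=
    le_ciInf fun f ↦ Real.sSup_le (hS f f.2) (norm_nonneg _)
  have hinf : ⨅ f : Hardy ∞, ‖h - (f : Lp ℂ ∞ μ𝕋)‖ ≤ ‖h - fopt‖ :=
    ciInf_le ⟨0, by rintro _ ⟨f, rfl⟩; positivity⟩ (⟨fopt, hfopt⟩ : Hardy ∞)
  exact ⟨⟨fopt, hfopt, le_antisymm (hle.trans hge) hinf⟩, le_antisymm (hinf.trans hle) hge⟩

end
end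

section
/- Almost-everywhere nonvanishing of H₂ functions. If f ∈ H₂ is not equal to zero almost everywhere, then f(e^{iω}) ≠ 0 for almost every ω ∈ [-π, π). -/
open MeasureTheory Complex Real ComplexConjugate AddCircle
open scoped ENNReal NNReal

noncomputable section

/-- A continuous linear map sending a set into a closed submodule sends the closed span of the set
into that submodule. -/
lemma map_mem_of_mem_closure_span {E F : Type*} [NormedAddCommGroup E] [NormedSpace ℂ E]
    [NormedAddCommGroup F] [NormedSpace ℂ F] (A : E →L[ℂ] F) {S : Set E} {V : Submodule ℂ F}
    (hV : IsClosed (V : Set F)) (hS : ∀ s ∈ S, A s ∈ V) {x : E}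
    (hx : x ∈ (Submodule.span ℂ S).topologicalClosure) : A x ∈ V := by
  have h : (Submodule.span ℂ S).topologicalClosure ≤ V.comap (A : E →ₗ[ℂ] F) :=
    Submodule.topologicalClosure_minimal _ (Submodule.span_le.2 hS) (hV.preimage A.continuous)
  exact h hx

section Circle

variable {T : ℝ} [hT : Fact (0 < T)]

/-- Finite measures on the circle are determined by their Fourier coefficients. -/
lemma measure_ext_of_integral_fourier {P Q : Measure (AddCircle T)} [IsFiniteMeasure P]
    [IsFiniteMeasure Q] (h : ∀ n : ℤ, ∫ x, fourier n x ∂P = ∫ x, fourier n x ∂Q) : P = Q := by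
  let A : StarSubalgebra ℂ (BoundedContinuousFunction (AddCircle T) ℂ) :=
    fourierSubalgebra.comap (BoundedContinuousFunction.toContinuousMapStarₐ ℂ)
  refine ext_of_forall_mem_subalgebra_integral_eq_of_pseudoEMetric_complete_countable (A := A) ?_ ?_
  · intro x y hxy
    obtain ⟨_, ⟨g, hg, rfl⟩, hne⟩ := fourierSubalgebra_separatesPoints (T := T) hxy
    exact ⟨_, ⟨g, ⟨BoundedContinuousFunction.mkOfCompact g, hg, rfl⟩, rfl⟩, hne⟩
  · intro g hg
    have hg' : g.toContinuousMap ∈ Submodule.span ℂ (Set.range (@fourier T)) := by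
      rw [← fourierSubalgebra_coe]
      exact hg
    have hint (R : Measure (AddCircle T)) [IsFiniteMeasure R] (u : C(AddCircle T, ℂ)) :
        Integrable u R := (BoundedContinuousFunction.mkOfCompact u).integrable R
    have key : ∀ u ∈ Submodule.span ℂ (Set.range (@fourier T)), ∫ x, u x ∂P = ∫ x, u x ∂Q := by
      intro u hu
      induction hu using Submodule.span_induction with
      | mem u hu =>
        obtain ⟨n, rfl⟩ := hu
        exact h n
      | zero => simp
      | add u v _ _ hu hv =>
        simp only [ContinuousMap.add_apply]
        rw [integral_add (hint P u) (hint P v), integral_add (hint Q u) (hint Q v), hu, hv]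
      | smul c u _ hu =>
        simp only [ContinuousMap.smul_apply]
        rw [integral_smul, integral_smul, hu]
    exact key _ hg'

/-- Multiplication by an essentially bounded function, as an operator on `L²` of the circle. -/
def mulLp (φ : Lp ℂ ∞ (@haarAddCircle T hT)) :
    Lp ℂ 2 (@haarAddCircle T hT) →L[ℂ] Lp ℂ 2 (@haarAddCircle T hT) :=
  (ContinuousLinearMap.mul ℂ ℂ).holderL haarAddCircle ∞ 2 2 φ

lemma coeFn_mulLp (φ : Lp ℂ ∞ (@haarAddCircle T hT)) (g : Lp ℂ 2 (@haarAddCircle T hT)) :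
    mulLp φ g =ᵐ[haarAddCircle] fun x ↦ φ x * g x :=
  (ContinuousLinearMap.mul ℂ ℂ).coeFn_holder φ g

/-- Multiplication by `fourier k`, as an operator on `L²` of the circle. -/
def shift (k : ℤ) : Lp ℂ 2 (@haarAddCircle T hT) →L[ℂ] Lp ℂ 2 (@haarAddCircle T hT) :=
  mulLp (fourierLp ∞ k)

lemma coeFn_shift (k : ℤ) (g : Lp ℂ 2 (@haarAddCircle T hT)) :
    shift k g =ᵐ[haarAddCircle] fun x ↦ fourier k x * g x := by
  filter_upwards [coeFn_mulLp (fourierLp ∞ k) g, coeFn_fourierLp ∞ k] with x h₁ h₂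
  rw [shift, h₁, h₂]

lemma shift_shift (j k : ℤ) (g : Lp ℂ 2 (@haarAddCircle T hT)) :
    shift j (shift k g) = shift (j + k) g := by
  apply Lp.ext
  filter_upwards [coeFn_shift j (shift k g), coeFn_shift k g, coeFn_shift (j + k) g]
    with x h₁ h₂ h₃
  rw [h₁, h₂, h₃, fourier_add, mul_assoc]

lemma fourierCoeff_shift (k n : ℤ) (g : Lp ℂ 2 (@haarAddCircle T hT)) :
    fourierCoeff (shift k g : AddCircle T → ℂ) n = fourierCoeff (g : AddCircle T → ℂ) (n - k) := by
  refine integral_congr_ae ?_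
  filter_upwards [coeFn_shift k g] with x hx
  rw [hx, smul_eq_mul, smul_eq_mul, ← mul_assoc, ← fourier_add]
  congr 3
  ring

lemma inner_fourierLp (n : ℤ) (g : Lp ℂ 2 (@haarAddCircle T hT)) :
    inner ℂ (fourierLp 2 n) g = fourierCoeff (g : AddCircle T → ℂ) n := by
  rw [← fourierBasis_repr, HilbertBasis.repr_apply_apply, coe_fourierBasis]

lemma inner_shift_self (n : ℤ) (h : Lp ℂ 2 (@haarAddCircle T hT)) :
    inner ℂ h (shift n h) = ∫ x, fourier n x * ((‖h x‖ ^ 2 : ℝ) : ℂ) ∂haarAddCircle := by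
  rw [L2.inner_def]
  refine integral_congr_ae ?_
  filter_upwards [coeFn_shift n h] with x hx
  rw [hx, RCLike.inner_apply, mul_assoc, RCLike.mul_conj]
  norm_cast

/-- A square-integrable function orthogonal to all its negative shifts has constant modulus: the
measure with density `|h|²` is a multiple of the Haar measure. -/
lemma withDensity_eq_of_inner_shift_eq_zero (h : Lp ℂ 2 (@haarAddCircle T hT))
    (horth : ∀ n : ℤ, n < 0 → inner ℂ h (shift n h) = 0) :
    haarAddCircle.withDensity (fun x ↦ ENNReal.ofReal (‖h x‖ ^ 2)) =
      ENNReal.ofReal (‖h‖ ^ 2) • haarAddCircle := by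
  have hint : Integrable (fun x ↦ ‖h x‖ ^ 2) (@haarAddCircle T hT) :=
    (memLp_two_iff_integrable_sq_norm (Lp.aestronglyMeasurable h)).1 (Lp.memLp h)
  have := isFiniteMeasure_withDensity_ofReal hint.2
  have : IsFiniteMeasure (ENNReal.ofReal (‖h‖ ^ 2) • @haarAddCircle T hT) :=
    Measure.smul_finite _ ENNReal.ofReal_ne_top
  apply measure_ext_of_integral_fourier
  have h₁ (n : ℤ) : ∫ x, fourier n x
      ∂haarAddCircle.withDensity (fun x ↦ ENNReal.ofReal (‖h x‖ ^ 2)) =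
      inner ℂ h (shift n h) := by
    rw [inner_shift_self, integral_withDensity_eq_integral_toReal_smul₀
      hint.1.aemeasurable.ennreal_ofReal (by simp)]
    refine integral_congr_ae (.of_forall fun x ↦ ?_)
    dsimp only
    rw [ENNReal.toReal_ofReal (by positivity), real_smul, mul_comm]
  have hneg (n : ℤ) : inner ℂ h (shift (-n) h) = conj (inner ℂ h (shift n h)) := by
    rw [inner_shift_self, inner_shift_self, ← integral_conj]
    simp only [map_mul, conj_ofReal, fourier_neg]
  intro n
  rw [h₁, integral_smul_measure, ENNReal.toReal_ofReal (by positivity)]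
  rcases eq_or_ne n 0 with rfl | hn
  · have h0 : shift 0 h = h := by
      apply Lp.ext
      filter_upwards [coeFn_shift 0 h] with x hx
      rw [hx, fourier_zero, one_mul]
    simp [h0, inner_self_eq_norm_sq_to_K]
  · have hz : ∫ x, fourier n x ∂@haarAddCircle T hT = 0 := by
      have := orthonormal_iff_ite.1 (@orthonormal_fourier T hT) 0 n
      rw [if_neg hn.symm, ContinuousMap.inner_toLp] at this
      simpa using this
    rw [hz, smul_zero]
    rcases hn.lt_or_gt with hlt | hgt
    · exact horth n hlt
    · have := hneg (-n)
      rwa [neg_neg, horth (-n) (by omega), map_zero] at this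

/-- A nonzero square-integrable function whose Fourier coefficients vanish above the index `m`,
where the coefficient is nonzero, is nonzero almost everywhere. -/
lemma ae_ne_zero_of_fourierCoeff (f : Lp ℂ 2 (@haarAddCircle T hT)) (m : ℤ)
    (hm : fourierCoeff (f : AddCircle T → ℂ) m ≠ 0)
    (hgt : ∀ n, m < n → fourierCoeff (f : AddCircle T → ℂ) n = 0) :
    ∀ᵐ x ∂haarAddCircle, (f : AddCircle T → ℂ) x ≠ 0 := by
  set S : Set (Lp ℂ 2 (@haarAddCircle T hT)) := {g | ∃ k : ℤ, k < 0 ∧ shift k f = g}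
  set K := (Submodule.span ℂ S).topologicalClosure
  have hKc : IsClosed (K : Set (Lp ℂ 2 (@haarAddCircle T hT))) :=
    Submodule.isClosed_topologicalClosure _
  have : CompleteSpace K := hKc.completeSpace_coe
  have hSK : S ⊆ K := Submodule.subset_span.trans (Submodule.le_topologicalClosure _)
  have hbot (F : Type) [NormedAddCommGroup F] [NormedSpace ℂ F] :
      IsClosed ((⊥ : Submodule ℂ F) : Set F) := isClosed_singleton
  set g : Lp ℂ 2 (@haarAddCircle T hT) := K.starProjection f
  have hgK : g ∈ K := K.starProjection_apply_mem f
  set h := f - g with hh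
  have horth : ∀ u ∈ K, inner ℂ h u = 0 := fun u hu ↦
    K.starProjection_inner_eq_zero f u hu
  have hshiftK {k : ℤ} (hk : k < 0) : shift k g ∈ K := by
    refine map_mem_of_mem_closure_span (shift k) hKc ?_ hgK
    rintro _ ⟨j, hj, rfl⟩
    exact hSK ⟨k + j, by omega, (shift_shift k j f).symm⟩
  have hne : h ≠ 0 := by
    intro h0
    have hgm : innerSL ℂ (fourierLp 2 m) g ∈ (⊥ : Submodule ℂ ℂ) := by
      refine map_mem_of_mem_closure_span _ (hbot ℂ) ?_ hgK
      rintro _ ⟨j, hj, rfl⟩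
      rw [Submodule.mem_bot, innerSL_apply_apply, inner_fourierLp, fourierCoeff_shift]
      exact hgt _ (by omega)
    rw [Submodule.mem_bot, innerSL_apply_apply, inner_fourierLp, ← sub_eq_zero.1 h0] at hgm
    exact hm hgm
  have hdens := withDensity_eq_of_inner_shift_eq_zero h fun n hn ↦ by
    apply horth
    rw [hh, map_sub]
    exact K.sub_mem (hSK ⟨n, hn, rfl⟩) (hshiftK hn)
  set E : Set (AddCircle T) := {x | f x = 0}
  have hEm : MeasurableSet E := (Lp.stronglyMeasurable f).measurable (measurableSet_singleton 0)
  have hfin : (@haarAddCircle T hT) E ≠ ∞ := measure_ne_top _ _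
  set χ := mulLp (indicatorConstLp ∞ hEm hfin (1 : ℂ)) with hχ
  have hχ_ae (u : Lp ℂ 2 (@haarAddCircle T hT)) :
      χ u =ᵐ[haarAddCircle] fun x ↦ E.indicator (fun _ ↦ (1 : ℂ)) x * u x := by
    filter_upwards [coeFn_mulLp (indicatorConstLp ∞ hEm hfin (1 : ℂ)) u,
      indicatorConstLp_coeFn (p := ∞) (hs := hEm) (hμs := hfin) (c := (1 : ℂ))] with x h₁ h₂
    rw [hχ, h₁, h₂]
  have hχf : χ f = 0 := by
    apply Lp.ext
    filter_upwards [hχ_ae f, Lp.coeFn_zero ℂ 2 (@haarAddCircle T hT)] with x h₁ h₂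
    rw [h₁, h₂]
    by_cases hx : x ∈ E
    · simp [show f x = 0 from hx]
    · simp [hx]
  have hχg : χ g = 0 := by
    refine (Submodule.mem_bot ℂ).1 (map_mem_of_mem_closure_span χ (hbot _) ?_ hgK)
    rintro _ ⟨j, hj, rfl⟩
    rw [Submodule.mem_bot]
    apply Lp.ext
    filter_upwards [hχ_ae (shift j f), coeFn_shift j f, Lp.coeFn_zero ℂ 2 (@haarAddCircle T hT)]
      with x h₁ h₂ h₃
    rw [h₁, h₂, h₃]
    by_cases hx : x ∈ E
    · simp [show f x = 0 from hx]
    · simp [hx]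
  have hχh : χ h = 0 := by rw [hh, map_sub, hχf, hχg, sub_zero]
  have hzero : ∀ᵐ x ∂@haarAddCircle T hT, x ∈ E → h x = 0 := by
    have := hχ_ae h
    rw [hχh] at this
    filter_upwards [this, Lp.coeFn_zero ℂ 2 (@haarAddCircle T hT)] with x h₁ h₂ hx
    rw [h₂] at h₁
    simpa [hx] using h₁.symm
  have hE0 : haarAddCircle.withDensity (fun x ↦ ENNReal.ofReal (‖h x‖ ^ 2)) E = 0 := by
    rw [withDensity_apply _ hEm]
    refine (setLIntegral_congr_fun_ae hEm (g := fun _ ↦ 0) ?_).trans (by simp)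
    filter_upwards [hzero] with x hx hxE
    simp [hx hxE]
  rw [hdens, Measure.smul_apply, smul_eq_mul, mul_eq_zero] at hE0
  refine ae_iff.2 ?_
  simp only [ne_eq, not_not]
  refine hE0.resolve_left ?_
  have := norm_pos_iff.2 hne
  rw [ENNReal.ofReal_eq_zero, not_le]
  positivity

end Circle

/-- **Almost-everywhere nonvanishing of `H₂` functions**: a nonzero `f ∈ H₂` is nonzero
almost everywhere on the circle. -/
theorem H2_ae_nonvanishing (f : Lp ℂ 2 μ𝕋) (hf : f ∈ Hardy 2) (hne : f ≠ 0) :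
    ∀ᵐ x ∂μ𝕋, (f : AddCircle (2 * π) → ℂ) x ≠ 0 := by
  have hex : ∃ n : ℤ, fourierCoeff (f : AddCircle (2 * π) → ℂ) n ≠ 0 := by
    by_contra! hall
    refine hne (fourierBasis.repr.injective (lp.ext (funext fun n ↦ ?_)))
    rw [fourierBasis_repr, hall n]
    simp
  obtain ⟨m, hm, hmax⟩ := Int.exists_greatest_of_bdd
    (P := fun n ↦ fourierCoeff (f : AddCircle (2 * π) → ℂ) n ≠ 0)
    ⟨0, fun n hn ↦ by by_contra! hlt; exact hn (hf n hlt)⟩ hex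
  refine ae_ne_zero_of_fourierCoeff f m hm fun n hn ↦ ?_
  by_contra hnz
  exact absurd (hmax n hnz) (not_le.2 hn)

end
end
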